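/- Characterization of critical unified sections (coordinate version of Theorem 4): Let L : J → ℝ be smooth. A triple (y, v, p) of smooth maps is a critical unified section if and only if the following three conditions hold: (i) v^A_ν(x) = ∂y^A/∂x^ν(x) for all x, A, ν (holonomy); (ii) p^ν_A(x) = (∂L/∂v^A_ν)(x, y(x), v(x)) for all x, A, ν (Legendre constraint); (iii) y satisfies the Euler–Lagrange equations for L at every point. -/

import Mathlib

open MeasureTheory

/-- Partial derivative of a real-valued function on `Fin m → ℝ` in the `ν`-th
coordinate direction. -/
noncomputable def pd {m : ℕ} (f : (Fin m → ℝ) → ℝ) (ν : Fin m) (x : Fin m → ℝ) : ℝ :=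
  fderiv ℝ f x (Pi.single ν 1)

/-- First jet prolongation of `φ`. -/
noncomputable def j1 {m n : ℕ} (φ : (Fin m → ℝ) → (Fin n → ℝ)) (x : Fin m → ℝ) :
    (Fin m → ℝ) × (Fin n → ℝ) × (Fin n → Fin m → ℝ) :=
  (x, φ x, fun A ν => pd (fun x' => φ x' A) ν x)

/-- Partial derivative of the Lagrangian in the `y^A` slot. -/
noncomputable def Ly {m n : ℕ} (L : (Fin m → ℝ) × (Fin n → ℝ) × (Fin n → Fin m → ℝ) → ℝ)
    (z : (Fin m → ℝ) × (Fin n → ℝ) × (Fin n → Fin m → ℝ)) (A : Fin n) : ℝ :=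
  fderiv ℝ L z (0, Pi.single A 1, 0)

/-- Partial derivative of the Lagrangian in the `v^A_ν` slot. -/
noncomputable def Lv {m n : ℕ} (L : (Fin m → ℝ) × (Fin n → ℝ) × (Fin n → Fin m → ℝ) → ℝ)
    (z : (Fin m → ℝ) × (Fin n → ℝ) × (Fin n → Fin m → ℝ)) (A : Fin n) (ν : Fin m) : ℝ :=
  fderiv ℝ L z (0, 0, Pi.single A (Pi.single ν 1))


/-- The unified (Lagrange–Hamilton) action density. -/
noncomputable def U {m n : ℕ} (L : (Fin m → ℝ) × (Fin n → ℝ) × (Fin n → Fin m → ℝ) → ℝ)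
    (y : (Fin m → ℝ) → (Fin n → ℝ)) (v p : (Fin m → ℝ) → (Fin n → Fin m → ℝ))
    (x : Fin m → ℝ) : ℝ :=
  L (x, y x, v x) +
    ∑ A : Fin n, ∑ ν : Fin m, p x A ν * (pd (fun x' => y x' A) ν x - v x A ν)

/-- `(y, v, p)` is a critical section of the unified action. -/
noncomputable def CriticalUnified {m n : ℕ}
    (L : (Fin m → ℝ) × (Fin n → ℝ) × (Fin n → Fin m → ℝ) → ℝ)
    (y : (Fin m → ℝ) → (Fin n → ℝ)) (v p : (Fin m → ℝ) → (Fin n → Fin m → ℝ)) : Prop :=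
  ∀ (Z : (Fin m → ℝ) → (Fin n → ℝ)) (V W : (Fin m → ℝ) → (Fin n → Fin m → ℝ)),
    ContDiff ℝ (⊤ : ℕ∞) Z → HasCompactSupport Z → ContDiff ℝ (⊤ : ℕ∞) V → HasCompactSupport V →
    ContDiff ℝ (⊤ : ℕ∞) W → HasCompactSupport W →
    HasDerivAt
      (fun t : ℝ => ∫ x : Fin m → ℝ,
        (U L (y + t • Z) (v + t • V) (p + t • W) x - U L y v p x)) 0 0

theorem hasDerivAt_integral_of_isCompact {E : Type*} [TopologicalSpace E] [T2Space E]
    [SecondCountableTopology E] [MeasurableSpace E] [BorelSpace E]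
    {μ : Measure E} [IsFiniteMeasureOnCompacts μ] {K : Set E} (hK : IsCompact K)
    {F F' : ℝ → E → ℝ} (t₀ : ℝ) (hF : ∀ t, Continuous (F t))
    (hF' : Continuous fun q : ℝ × E => F' q.1 q.2)
    (hF_zero : ∀ x ∉ K, F t₀ x = 0) (hF'_zero : ∀ t, ∀ x ∉ K, F' t x = 0)
    (hderiv : ∀ t x, HasDerivAt (fun s => F s x) (F' t x) t) :
    HasDerivAt (fun t => ∫ x, F t x ∂μ) (∫ x, F' t₀ x ∂μ) t₀ := by
  obtain ⟨C, hC⟩ := ((isCompact_closedBall t₀ 1).prod hK).exists_bound_of_continuousOn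
    hF'.continuousOn
  have hbound : Integrable (K.indicator fun _ => C) μ :=
    (integrable_indicator_iff hK.measurableSet).2 (integrableOn_const hK.measure_lt_top.ne)
  refine (hasDerivAt_integral_of_dominated_loc_of_deriv_le
    (Metric.closedBall_mem_nhds t₀ one_pos)
    (.of_forall fun t => (hF t).aestronglyMeasurable)
    ((hF t₀).integrable_of_hasCompactSupport (.intro hK fun x hx => hF_zero x hx))
    (by fun_prop : Continuous (F' t₀)).aestronglyMeasurable
    (.of_forall fun x t ht => ?_) hbound (.of_forall fun x t _ => hderiv t x)).2
  by_cases hx : x ∈ K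
  · simpa [hx] using hC (t, x) ⟨ht, hx⟩
  · simp [hx, hF'_zero t x hx]

section

variable {m n : ℕ}

theorem contDiff_pd {f : (Fin m → ℝ) → ℝ} (hf : ContDiff ℝ (⊤ : ℕ∞) f) (ν : Fin m) :
    ContDiff ℝ (⊤ : ℕ∞) (pd f ν) :=
  (hf.fderiv_right (m := (⊤ : ℕ∞)) (by simp)).clm_apply contDiff_const

theorem pd_add_const_mul {f g : (Fin m → ℝ) → ℝ} (hf : ContDiff ℝ (⊤ : ℕ∞) f)
    (hg : ContDiff ℝ (⊤ : ℕ∞) g) (t : ℝ) (ν : Fin m) (x : Fin m → ℝ) :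
    pd (fun x' => f x' + t * g x') ν x = pd f ν x + t * pd g ν x := by
  have hf' := (hf.differentiable (by simp) x).hasFDerivAt
  have hg' := (hg.differentiable (by simp) x).hasFDerivAt
  have h := (hf'.add (hg'.const_mul t)).fderiv
  exact congrArg (fun T => T (Pi.single ν 1)) h

theorem pd_eq_zero_of_notMem_tsupport {f : (Fin m → ℝ) → ℝ} {x : Fin m → ℝ}
    (hx : x ∉ tsupport f) (ν : Fin m) : pd f ν x = 0 := by
  simp [pd, fderiv_of_notMem_tsupport ℝ hx]

theorem integrable_and_integral_mul_pd_add_pd_mul_eq_zero {f g : (Fin m → ℝ) → ℝ}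
    (hf : ContDiff ℝ (⊤ : ℕ∞) f) (hg : ContDiff ℝ (⊤ : ℕ∞) g) (hgc : HasCompactSupport g)
    (ν : Fin m) :
    Integrable (fun x => f x * pd g ν x + pd f ν x * g x) ∧
      ∫ x, (f x * pd g ν x + pd f ν x * g x) = 0 := by
  have hpf := (contDiff_pd hf ν).continuous
  have hpg := (contDiff_pd hg ν).continuous
  have h1 : Integrable (fun x => pd f ν x * g x) :=
    (hpf.mul hg.continuous).integrable_of_hasCompactSupport hgc.mul_left
  have h2 : Integrable (fun x => f x * pd g ν x) :=
    (hf.continuous.mul hpg).integrable_of_hasCompactSupport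
      (.intro hgc fun x hx => by simp [pd_eq_zero_of_notMem_tsupport hx])
  have h3 : Integrable (fun x => f x * g x) :=
    (hf.continuous.mul hg.continuous).integrable_of_hasCompactSupport hgc.mul_left
  refine ⟨h2.add h1, ?_⟩
  rw [integral_add h2 h1]
  have := integral_mul_fderiv_eq_neg_fderiv_mul_of_integrable h1 h2 h3
    (fun x _ => hf.differentiable (by simp) x) (fun x _ => hg.differentiable (by simp) x)
  simp only [pd] at this ⊢
  rw [this, neg_add_cancel]

theorem fderiv_apply_vertical (L : (Fin m → ℝ) × (Fin n → ℝ) × (Fin n → Fin m → ℝ) → ℝ)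
    (z : (Fin m → ℝ) × (Fin n → ℝ) × (Fin n → Fin m → ℝ)) (a : Fin n → ℝ)
    (b : Fin n → Fin m → ℝ) :
    fderiv ℝ L z (0, a, b) =
      ∑ A, Ly L z A * a A + ∑ A, ∑ ν, Lv L z A ν * b A ν := by
  have h : ((0, a, b) : (Fin m → ℝ) × (Fin n → ℝ) × (Fin n → Fin m → ℝ)) =
      ∑ A, a A • (0, Pi.single A 1, 0) +
        ∑ A, ∑ ν, b A ν • (0, 0, Pi.single A (Pi.single ν 1)) := by
    refine Prod.ext ?_ (Prod.ext ?_ ?_)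
    · simp [Prod.fst_sum]
    · ext B
      simp [Prod.fst_sum, Prod.snd_sum, Pi.single_apply]
    · ext B ν
      simp [Prod.snd_sum, Pi.single_apply, Finset.sum_apply, apply_ite]
  rw [h]
  simp only [map_add, map_sum, map_smul, Ly, Lv, smul_eq_mul, mul_comm]

theorem continuous_Ly {L : (Fin m → ℝ) × (Fin n → ℝ) × (Fin n → Fin m → ℝ) → ℝ}
    (hL : ContDiff ℝ (⊤ : ℕ∞) L) (A : Fin n) : Continuous fun z => Ly L z A :=
  (hL.continuous_fderiv (by simp)).clm_apply continuous_const

theorem continuous_Lv {L : (Fin m → ℝ) × (Fin n → ℝ) × (Fin n → Fin m → ℝ) → ℝ}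
    (hL : ContDiff ℝ (⊤ : ℕ∞) L) (A : Fin n) (ν : Fin m) : Continuous fun z => Lv L z A ν :=
  (hL.continuous_fderiv (by simp)).clm_apply continuous_const

/-- The integrand of the first variation of the unified action in the direction `(Z, V, W)`,
after integration by parts. -/
noncomputable def firstVariation (L : (Fin m → ℝ) × (Fin n → ℝ) × (Fin n → Fin m → ℝ) → ℝ)
    (y : (Fin m → ℝ) → (Fin n → ℝ)) (v p : (Fin m → ℝ) → (Fin n → Fin m → ℝ))
    (Z : (Fin m → ℝ) → (Fin n → ℝ)) (V W : (Fin m → ℝ) → (Fin n → Fin m → ℝ))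
    (x : Fin m → ℝ) : ℝ :=
  ∑ A, (Ly L (x, y x, v x) A - ∑ ν, pd (fun x' => p x' A ν) ν x) * Z x A +
    ∑ A, ∑ ν, (Lv L (x, y x, v x) A ν - p x A ν) * V x A ν +
    ∑ A, ∑ ν, (pd (fun x' => y x' A) ν x - v x A ν) * W x A ν

theorem hasDerivAt_integral_U {L : (Fin m → ℝ) × (Fin n → ℝ) × (Fin n → Fin m → ℝ) → ℝ}
    (hL : ContDiff ℝ (⊤ : ℕ∞) L)
    {y : (Fin m → ℝ) → (Fin n → ℝ)} (hy : ContDiff ℝ (⊤ : ℕ∞) y)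
    {v p : (Fin m → ℝ) → (Fin n → Fin m → ℝ)} (hv : ContDiff ℝ (⊤ : ℕ∞) v)
    (hp : ContDiff ℝ (⊤ : ℕ∞) p)
    {Z : (Fin m → ℝ) → (Fin n → ℝ)} {V W : (Fin m → ℝ) → (Fin n → Fin m → ℝ)}
    (hZ : ContDiff ℝ (⊤ : ℕ∞) Z) (hZc : HasCompactSupport Z)
    (hV : ContDiff ℝ (⊤ : ℕ∞) V) (hVc : HasCompactSupport V)
    (hW : ContDiff ℝ (⊤ : ℕ∞) W) (hWc : HasCompactSupport W) :
    HasDerivAt (fun t : ℝ => ∫ x : Fin m → ℝ,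
      (U L (y + t • Z) (v + t • V) (p + t • W) x - U L y v p x))
      (∫ x, firstVariation L y v p Z V W x) 0 := by
  have hyA (A) : ContDiff ℝ (⊤ : ℕ∞) fun x => y x A := contDiff_pi.1 hy A
  have hZA (A) : ContDiff ℝ (⊤ : ℕ∞) fun x => Z x A := contDiff_pi.1 hZ A
  have hpA (A ν) : ContDiff ℝ (⊤ : ℕ∞) fun x => p x A ν := contDiff_pi.1 (contDiff_pi.1 hp A) ν
  have hyd (A ν) : Continuous (pd (fun x => y x A) ν) := (contDiff_pd (hyA A) ν).continuous
  have hZd (A ν) : Continuous (pd (fun x => Z x A) ν) := (contDiff_pd (hZA A) ν).continuous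
  have hpd (A ν) : Continuous (pd (fun x => p x A ν) ν) := (contDiff_pd (hpA A ν) ν).continuous
  have hyc := hy.continuous
  have hvc := hv.continuous
  have hpc := hp.continuous
  have hZcont := hZ.continuous
  have hVcont := hV.continuous
  have hWcont := hW.continuous
  have hLc := hL.continuous
  have hL'c := hL.continuous_fderiv (by simp)
  have hLyc := continuous_Ly hL
  have hLvc := continuous_Lv hL
  let K := tsupport Z ∪ tsupport V ∪ tsupport W
  have hK : IsCompact K := (hZc.union hVc).union hWc
  have hZ0 : ∀ x ∉ K, Z x = 0 := fun x hx =>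
    image_eq_zero_of_notMem_tsupport fun h => hx (.inl (.inl h))
  have hV0 : ∀ x ∉ K, V x = 0 := fun x hx =>
    image_eq_zero_of_notMem_tsupport fun h => hx (.inl (.inr h))
  have hW0 : ∀ x ∉ K, W x = 0 := fun x hx =>
    image_eq_zero_of_notMem_tsupport fun h => hx (.inr h)
  have hZd0 (A ν) : ∀ x ∉ K, pd (fun x' => Z x' A) ν x = 0 := fun x hx =>
    pd_eq_zero_of_notMem_tsupport
      (fun h => hx (.inl (.inl (tsupport_comp_subset (g := fun a : Fin n → ℝ => a A) rfl Z h)))) ν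
  have hU (t : ℝ) (x) : U L (y + t • Z) (v + t • V) (p + t • W) x =
      L (x, y x + t • Z x, v x + t • V x) +
        ∑ A, ∑ ν, (p x A ν + t * W x A ν) *
          (pd (fun x' => y x' A) ν x + t * pd (fun x' => Z x' A) ν x -
            (v x A ν + t * V x A ν)) := by
    simp [U, pd_add_const_mul (hyA _) (hZA _)]
  have key := hasDerivAt_integral_of_isCompact (μ := volume) hK
    (F := fun t x => U L (y + t • Z) (v + t • V) (p + t • W) x - U L y v p x)
    (F' := fun t x => fderiv ℝ L (x, y x + t • Z x, v x + t • V x) (0, Z x, V x) +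
      ∑ A, ∑ ν, (W x A ν * (pd (fun x' => y x' A) ν x + t * pd (fun x' => Z x' A) ν x -
            (v x A ν + t * V x A ν)) + (p x A ν + t * W x A ν) *
          (pd (fun x' => Z x' A) ν x - V x A ν))) 0
    (fun t => by simp only [hU]; unfold U; fun_prop) (by fun_prop) (fun x _ => by simp)
    (fun t x hx => by
      have h0 : ((0, 0, 0) : (Fin m → ℝ) × (Fin n → ℝ) × (Fin n → Fin m → ℝ)) = 0 := rfl
      simp [hZ0 x hx, hV0 x hx, hW0 x hx, hZd0 _ _ x hx, h0])
    (fun t x => by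
      simp only [hU]
      have h1 : HasDerivAt (fun s : ℝ => (x, y x + s • Z x, v x + s • V x))
          (0, Z x, V x) t := by
        have hZt : HasDerivAt (fun s : ℝ => y x + s • Z x) (Z x) t := by
          simpa using ((hasDerivAt_id t).smul_const (Z x)).const_add (y x)
        have hVt : HasDerivAt (fun s : ℝ => v x + s • V x) (V x) t := by
          simpa using ((hasDerivAt_id t).smul_const (V x)).const_add (v x)
        exact (hasDerivAt_const t x).prodMk (hZt.prodMk hVt)
      have h2 := (hL.differentiable (by simp)
        (x, y x + t • Z x, v x + t • V x)).hasFDerivAt.comp_hasDerivAt t h1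
      refine (h2.add (.fun_sum fun A _ => .fun_sum fun ν _ => ?_)).sub_const _
      have h3 (a b : ℝ) : HasDerivAt (fun s : ℝ => a + s * b) b t := by
        simpa using ((hasDerivAt_id t).mul_const b).const_add a
      exact (h3 _ _).mul ((h3 _ _).sub (h3 _ _)))
  convert key using 1
  have hparts (A ν) := integrable_and_integral_mul_pd_add_pd_mul_eq_zero (hpA A ν) (hZA A)
    (hZc.comp_left (g := fun a : Fin n → ℝ => a A) rfl) ν
  have hfv : Integrable (firstVariation L y v p Z V W) := by
    refine Continuous.integrable_of_hasCompactSupport ?_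
      (.intro hK fun x hx => by simp [firstVariation, hZ0 x hx, hV0 x hx, hW0 x hx])
    unfold firstVariation
    fun_prop
  have hsum : ∫ x, ∑ A, ∑ ν, (p x A ν * pd (fun x' => Z x' A) ν x +
      pd (fun x' => p x' A ν) ν x * Z x A) = 0 := by
    rw [integral_finsetSum _ fun A _ => integrable_finsetSum _ fun ν _ => (hparts A ν).1]
    refine Finset.sum_eq_zero fun A _ => ?_
    rw [integral_finsetSum _ fun ν _ => (hparts A ν).1]
    exact Finset.sum_eq_zero fun ν _ => (hparts A ν).2
  have hadd := integral_add hfv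
    (integrable_finsetSum Finset.univ fun A _ =>
      integrable_finsetSum Finset.univ fun ν _ => (hparts A ν).1)
  rw [hsum, add_zero] at hadd
  rw [← hadd]
  congr 1 with x
  simp only [firstVariation, fderiv_apply_vertical, zero_smul, zero_mul, add_zero, sub_mul,
    Finset.sum_mul, mul_sub, Finset.sum_add_distrib, Finset.sum_sub_distrib, mul_comm (W x _ _)]
  ring

theorem eq_zero_of_integral_mul_eq_zero {f : (Fin m → ℝ) → ℝ} (hf : Continuous f)
    (h : ∀ g : (Fin m → ℝ) → ℝ, ContDiff ℝ (⊤ : ℕ∞) g → HasCompactSupport g →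
      ∫ x, f x * g x = 0) (x : Fin m → ℝ) : f x = 0 := by
  have hae := ae_eq_zero_of_integral_contDiff_smul_eq_zero (μ := volume) hf.locallyIntegrable
    fun g hg hgc => by simpa [mul_comm] using h g hg hgc
  exact congrFun (Continuous.ae_eq_iff_eq volume hf continuous_const |>.1 hae) x

end

/-- Characterization of critical unified sections. -/
theorem critical_unified_section_iff
    (m n : ℕ) (hm : 0 < m) (hn : 0 < n)
    (L : (Fin m → ℝ) × (Fin n → ℝ) × (Fin n → Fin m → ℝ) → ℝ) (hL : ContDiff ℝ (⊤ : ℕ∞) L)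
    (y : (Fin m → ℝ) → (Fin n → ℝ)) (hy : ContDiff ℝ (⊤ : ℕ∞) y)
    (v : (Fin m → ℝ) → (Fin n → Fin m → ℝ)) (hv : ContDiff ℝ (⊤ : ℕ∞) v)
    (p : (Fin m → ℝ) → (Fin n → Fin m → ℝ)) (hp : ContDiff ℝ (⊤ : ℕ∞) p) :
    CriticalUnified L y v p ↔
      ((∀ (x : Fin m → ℝ) (A : Fin n) (ν : Fin m),
          v x A ν = pd (fun x' => y x' A) ν x) ∧
        (∀ (x : Fin m → ℝ) (A : Fin n) (ν : Fin m),
          p x A ν = Lv L (x, y x, v x) A ν) ∧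
        (∀ (x : Fin m → ℝ) (A : Fin n),
          Ly L (j1 y x) A - ∑ ν : Fin m, pd (fun x' => Lv L (j1 y x') A ν) ν x = 0)) := by
  have hyA (A) : ContDiff ℝ (⊤ : ℕ∞) fun x => y x A := contDiff_pi.1 hy A
  have hpA (A ν) : ContDiff ℝ (⊤ : ℕ∞) fun x => p x A ν := contDiff_pi.1 (contDiff_pi.1 hp A) ν
  have hyd (A ν) : Continuous (pd (fun x => y x A) ν) := (contDiff_pd (hyA A) ν).continuous
  have hpd (A ν) : Continuous (pd (fun x => p x A ν) ν) := (contDiff_pd (hpA A ν) ν).continuous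
  have hyc := hy.continuous
  have hvc := hv.continuous
  have hpc := hp.continuous
  have hLyc := continuous_Ly hL
  have hLvc := continuous_Lv hL
  have hj1 (hol : ∀ x A ν, v x A ν = pd (fun x' => y x' A) ν x) (x) :
      j1 y x = (x, y x, v x) := by
    have : v x = fun A ν => pd (fun x' => y x' A) ν x := by
      ext A ν
      exact hol x A ν
    rw [j1, this]
  constructor
  · intro h
    have hcrit : ∀ (Z : (Fin m → ℝ) → (Fin n → ℝ)) (V W : (Fin m → ℝ) → (Fin n → Fin m → ℝ)),
        ContDiff ℝ (⊤ : ℕ∞) Z → HasCompactSupport Z → ContDiff ℝ (⊤ : ℕ∞) V →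
        HasCompactSupport V → ContDiff ℝ (⊤ : ℕ∞) W → HasCompactSupport W →
        ∫ x, firstVariation L y v p Z V W x = 0 := fun Z V W hZ hZc hV hVc hW hWc =>
      (hasDerivAt_integral_U hL hy hv hp hZ hZc hV hVc hW hWc).unique
        (h Z V W hZ hZc hV hVc hW hWc)
    have smooth_single {f : (Fin m → ℝ) → ℝ} (hf : ContDiff ℝ (⊤ : ℕ∞) f) (A : Fin n)
        (ν : Fin m) : ContDiff ℝ (⊤ : ℕ∞) fun x =>
          (Pi.single A (Pi.single ν (f x)) : Fin n → Fin m → ℝ) :=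
      ((ContinuousLinearMap.single ℝ (fun _ : Fin n => Fin m → ℝ) A).comp
        (ContinuousLinearMap.single ℝ (fun _ : Fin m => ℝ) ν)).contDiff.comp hf
    have compact_single {f : (Fin m → ℝ) → ℝ} (hf : HasCompactSupport f) (A : Fin n)
        (ν : Fin m) : HasCompactSupport fun x =>
          (Pi.single A (Pi.single ν (f x)) : Fin n → Fin m → ℝ) :=
      hf.comp_left (g := fun a : ℝ => (Pi.single A (Pi.single ν a) : Fin n → Fin m → ℝ))
        (by simp)
    have sum_single (c : Fin n → Fin m → ℝ) (A : Fin n) (ν : Fin m) (a : ℝ) :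
        ∑ B, ∑ μ, c B μ * (Pi.single A (Pi.single ν a) : Fin n → Fin m → ℝ) B μ = c A ν * a := by
      simp [Pi.single_apply, ite_apply]
    have hol (x A ν) : pd (fun x' => y x' A) ν x - v x A ν = 0 := by
      refine eq_zero_of_integral_mul_eq_zero (f := fun x => pd (fun x' => y x' A) ν x - v x A ν)
        (by fun_prop) (fun g hg hgc => ?_) x
      simpa [firstVariation, sum_single] using hcrit 0 0 _ contDiff_const .zero
        contDiff_const .zero (smooth_single hg A ν) (compact_single hgc A ν)
    have leg (x A ν) : Lv L (x, y x, v x) A ν - p x A ν = 0 := by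
      refine eq_zero_of_integral_mul_eq_zero (f := fun x => Lv L (x, y x, v x) A ν - p x A ν)
        (by fun_prop) (fun g hg hgc => ?_) x
      simpa [firstVariation, sum_single] using hcrit 0 _ 0 contDiff_const .zero
        (smooth_single hg A ν) (compact_single hgc A ν) contDiff_const .zero
    have hol' (x A ν) : v x A ν = pd (fun x' => y x' A) ν x := (sub_eq_zero.1 (hol x A ν)).symm
    have leg' (x A ν) : p x A ν = Lv L (x, y x, v x) A ν := (sub_eq_zero.1 (leg x A ν)).symm
    refine ⟨hol', leg', fun x A => ?_⟩
    simp only [hj1 hol', ← leg']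
    refine eq_zero_of_integral_mul_eq_zero
      (f := fun x => Ly L (x, y x, v x) A - ∑ ν, pd (fun x' => p x' A ν) ν x)
      (by fun_prop) (fun g hg hgc => ?_) x
    simpa [firstVariation, Pi.single_apply] using hcrit (fun x => Pi.single A (g x)) 0 0
      ((ContinuousLinearMap.single ℝ (fun _ : Fin n => ℝ) A).contDiff.comp hg)
      (hgc.comp_left (g := fun a : ℝ => (Pi.single A a : Fin n → ℝ)) (by simp))
      contDiff_const .zero contDiff_const .zero
  · rintro ⟨hol, leg, el⟩ Z V W hZ hZc hV hVc hW hWc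
    simp only [hj1 hol, ← leg] at el
    convert hasDerivAt_integral_U hL hy hv hp hZ hZc hV hVc hW hWc using 1
    simp [firstVariation, ← hol, ← leg, el]
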